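/- Let S be a commutative ring, let (F,∂) be a chain complex of S-modules indexed by the natural numbers, let f ∈ S, let σ be a homotopy for f on F, and let N be an S-module with f·N = 0. Then (∂_{n+2}⊗id_N)∘(σ_{n+1}⊗id_N) + (σ_n⊗id_N)∘(∂_{n+1}⊗id_N) = 0 as maps F_{n+1}⊗_S N → F_{n+1}⊗_S N-shifted data for all n; consequently each σ_n⊗id_N carries ker(∂_n⊗id_N) into ker(∂_{n+1}⊗id_N) and carries im(∂_{n+1}⊗id_N) into im(∂_{n+2}⊗id_N), and hence induces an S-linear map H_n(F⊗N) → H_{n+1}(F⊗N). -/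

import Mathlib

open LinearMap

/-- Multiplication by a scalar that annihilates `N` becomes zero after tensoring with `N`. -/
theorem rTensor_smul_id_eq_zero {S M N : Type*} [CommRing S] [AddCommGroup M] [Module S M]
    [AddCommGroup N] [Module S N] {f : S} (hN : ∀ x : N, f • x = 0) :
    rTensor N (f • (LinearMap.id : M →ₗ[S] M)) = 0 := by
  ext m x
  simp [← TensorProduct.tmul_smul, hN]

/-- If `σ` is a homotopy for `f` on a chain complex `(F, ∂)` of `S`-modules and
`N` is an `S`-module with `f·N = 0`, then `(∂⊗id)∘(σ⊗id) + (σ⊗id)∘(∂⊗id) = 0`; consequently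
each `σ_n⊗id_N` carries cycles to cycles and boundaries to boundaries, and hence induces an
`S`-linear map `H_n(F⊗N) → H_{n+1}(F⊗N)`. -/
theorem stmt2
    {S : Type*} [CommRing S]
    (F : ℕ → Type*)
    [∀ n, AddCommGroup (F n)] [∀ n, Module S (F n)]
    (dF : ∀ n, F (n + 1) →ₗ[S] F n)
    (hdF : ∀ n, (dF n).comp (dF (n + 1)) = 0)
    (f : S)
    (σ : ∀ n, F n →ₗ[S] F (n + 1))
    (hσ0 : (dF 0).comp (σ 0) = f • (LinearMap.id : F 0 →ₗ[S] F 0))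
    (hσ : ∀ n, (dF (n + 1)).comp (σ (n + 1)) + (σ n).comp (dF n)
        = f • (LinearMap.id : F (n + 1) →ₗ[S] F (n + 1)))
    (N : Type*) [AddCommGroup N] [Module S N]
    (hN : ∀ x : N, f • x = 0) :
    -- the tensored homotopy identity (with `f•id ⊗ id_N = 0`)
    (∀ n, (rTensor N (dF (n + 1))).comp (rTensor N (σ (n + 1)))
        + (rTensor N (σ n)).comp (rTensor N (dF n)) = 0) ∧
    ((rTensor N (dF 0)).comp (rTensor N (σ 0)) = 0) ∧
    -- cycles are carried to cycles (degree 0, where every element of `F 0 ⊗ N` is a cycle)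
    (∀ x : TensorProduct S (F 0) N, rTensor N (σ 0) x ∈ ker (rTensor N (dF 0))) ∧
    -- cycles are carried to cycles (positive degrees)
    (∀ n, ∀ x ∈ ker (rTensor N (dF n)),
        rTensor N (σ (n + 1)) x ∈ ker (rTensor N (dF (n + 1)))) ∧
    -- boundaries are carried to boundaries
    (∀ n, ∀ x ∈ range (rTensor N (dF n)),
        rTensor N (σ n) x ∈ range (rTensor N (dF (n + 1)))) := by
  have h0 : (rTensor N (dF 0)).comp (rTensor N (σ 0)) = 0 := by
    rw [← rTensor_comp, hσ0, rTensor_smul_id_eq_zero hN]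
  have hs : ∀ n, (rTensor N (dF (n + 1))).comp (rTensor N (σ (n + 1)))
      + (rTensor N (σ n)).comp (rTensor N (dF n)) = 0 := fun n => by
    rw [← rTensor_comp, ← rTensor_comp, ← rTensor_add, hσ, rTensor_smul_id_eq_zero hN]
  refine ⟨hs, h0, fun x => LinearMap.congr_fun h0 x, fun n x hx => ?_, ?_⟩
  · have h := LinearMap.congr_fun (hs n) x
    simpa [mem_ker.mp hx] using h
  · rintro n _ ⟨y, rfl⟩
    refine ⟨-rTensor N (σ (n + 1)) y, ?_⟩
    rw [map_neg]
    exact neg_eq_of_add_eq_zero_right (LinearMap.congr_fun (hs n) y)
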